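/- Fix n ≥ 2, d, b, w, p ∈ ℕ with p ≥ 1 and w·p + ⌈log₂ n⌉ ≤ b, and let S := Fin w → Fin (2^p). Let P be a predicate on n-node inputs with node attributes in S. If for every state type Σ no b-bit CONGEST algorithm of d rounds (for any choice of initialization, message, update, and output functions) decides P, then for every finite-precision message-passing GNN of depth d, width w, and precision p and every out : S → Bool, the GNN does not decide P. (Lower-bound transfer theorem: round lower bounds in CONGEST with b-bit messages imply depth lower bounds for GNNs of width at most (b − log₂ n)/p.) -/

import Mathlib

/-- The closed neighborhood `N*(i) = {i} ∪ {j | G.Adj i j}` of a node, as a `Finset`. -/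
noncomputable def Nstar {n : ℕ} (G : SimpleGraph (Fin n)) (i : Fin n) : Finset (Fin n) := by
  classical exact Finset.univ.filter (fun j => j = i ∨ G.Adj i j)

/-- The state `x_i(ℓ)` of a finite-precision message-passing GNN of width `w` and
precision `p`, with messaging functions `Msg` and update functions `Up`, run on the
attributed graph `(G, a, β)` on `n` nodes.  The messages are summed pointwise in
`Fin w → ℝ` after the coordinatewise natural-number-cast embedding `ι`. -/
noncomputable def fpState {n w p : ℕ}
    (Msg : ℕ → (Fin w → Fin (2^p)) × (Fin w → Fin (2^p)) × Fin n × Fin n × ℕ →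
      (Fin w → Fin (2^p)))
    (Up : ℕ → (Fin w → ℝ) → (Fin w → Fin (2^p)))
    (G : SimpleGraph (Fin n)) (a : Fin n → Fin w → Fin (2^p)) (β : Fin n → Fin n → ℕ) :
    ℕ → Fin n → Fin w → Fin (2^p)
  | 0, i => a i
  | (ℓ+1), i => Up (ℓ+1) (∑ j ∈ Nstar G i, fun k =>
      ((Msg (ℓ+1) (fpState Msg Up G a β ℓ i, fpState Msg Up G a β ℓ j, i, j, β i j)) k : ℝ))

/-- The identically-zero finite-precision node attribute. -/
noncomputable def zeroS (w p : ℕ) : Fin w → Fin (2^p) := fun _ => ⟨0, by positivity⟩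

/-- The state `s_i(ℓ)` of a CONGEST-style algorithm with state type `St`, node-attribute
type `S₀`, and message type `T` (take `T := Fin (2^b)` for the `b`-bit CONGEST model),
given by an initialization `init`, message functions `M` and update functions `U`,
run on the attributed graph `(G, a, β)` on `n` nodes. -/
noncomputable def congestState {n : ℕ} {S₀ St T : Type*}
    (init : S₀ × Fin n → St)
    (M : ℕ → St × Fin n → T)
    (U : ℕ → Multiset (T × ℕ) × Fin n → St)
    (G : SimpleGraph (Fin n)) (a : Fin n → S₀) (β : Fin n → Fin n → ℕ) :
    ℕ → Fin n → St
  | 0, i => init (a i, i)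
  | (ℓ+1), i => U (ℓ+1) (((Nstar G i).val).map
      (fun j => (M (ℓ+1) (congestState init M U G a β ℓ j, j), β i j)), i)

theorem mem_Nstar_self {n : ℕ} (G : SimpleGraph (Fin n)) (i : Fin n) : i ∈ Nstar G i := by
  simp [Nstar]

/-- A node attribute together with a node identifier fits into `b` bits. -/
theorem exists_injective_encoding {n b w p : ℕ} (hb : w * p + Nat.clog 2 n ≤ b) :
    ∃ enc : (Fin w → Fin (2^p)) × Fin n → Fin (2^b), Function.Injective enc := by
  suffices h : Fintype.card ((Fin w → Fin (2^p)) × Fin n) ≤ Fintype.card (Fin (2^b)) from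
    (Function.Embedding.nonempty_of_card_le h).elim fun f => ⟨f, f.injective⟩
  calc Fintype.card ((Fin w → Fin (2^p)) × Fin n)
      = 2 ^ (w * p) * n := by simp [← pow_mul, mul_comm]
    _ ≤ 2 ^ (w * p) * 2 ^ Nat.clog 2 n :=
      Nat.mul_le_mul_left _ (Nat.le_pow_clog one_lt_two n)
    _ = 2 ^ (w * p + Nat.clog 2 n) := (pow_add _ _ _).symm
    _ ≤ 2 ^ b := Nat.pow_le_pow_right two_pos hb
    _ = Fintype.card (Fin (2^b)) := (Fintype.card_fin _).symm

open Classical in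
/-- The attribute attached to the identifier `i` in a multiset of messages decoded by `dec`
(zero if there is none). -/
noncomputable def attributeOf {n w p : ℕ} {T : Type*} (dec : T → (Fin w → Fin (2^p)) × Fin n)
    (m : Multiset (T × ℕ)) (i : Fin n) : Fin w → Fin (2^p) :=
  if h : ∃ q ∈ m, (dec q.1).2 = i then (dec h.choose.1).1 else zeroS w p

theorem attributeOf_map {n w p : ℕ} {T : Type*} {enc : (Fin w → Fin (2^p)) × Fin n → T}
    {dec : T → (Fin w → Fin (2^p)) × Fin n} (hdec : Function.LeftInverse dec enc)
    (s : Multiset (Fin n)) (x : Fin n → Fin w → Fin (2^p)) (c : Fin n → ℕ)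
    {i : Fin n} (hi : i ∈ s) :
    attributeOf dec (s.map fun j => (enc (x j, j), c j)) i = x i := by
  have h : ∃ q ∈ s.map (fun j => (enc (x j, j), c j)), (dec q.1).2 = i :=
    ⟨_, Multiset.mem_map_of_mem _ hi, by simp [hdec _]⟩
  rw [attributeOf, dif_pos h]
  obtain ⟨hmem, hid⟩ := h.choose_spec
  obtain ⟨j, -, hj⟩ := Multiset.mem_map.1 hmem
  rw [← hj, hdec] at hid ⊢
  exact congrArg x hid

/-- The CONGEST update that recovers all sender states and evaluates a GNN layer. -/
noncomputable def gnnUpdate {n w p : ℕ} {T : Type*}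
    (Msg : ℕ → (Fin w → Fin (2^p)) × (Fin w → Fin (2^p)) × Fin n × Fin n × ℕ →
      (Fin w → Fin (2^p)))
    (Up : ℕ → (Fin w → ℝ) → (Fin w → Fin (2^p)))
    (dec : T → (Fin w → Fin (2^p)) × Fin n) (ℓ : ℕ) (q : Multiset (T × ℕ) × Fin n) :
    Fin w → Fin (2^p) :=
  Up ℓ (q.1.map fun t => fun k =>
    ((Msg ℓ (attributeOf dec q.1 q.2, (dec t.1).1, q.2, (dec t.1).2, t.2)) k : ℝ)).sum

/-- A CONGEST algorithm broadcasting encoded states and identifiers simulates the GNN. -/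
theorem congestState_gnnUpdate {n w p : ℕ} {T : Type*}
    {enc : (Fin w → Fin (2^p)) × Fin n → T}
    {dec : T → (Fin w → Fin (2^p)) × Fin n} (hdec : Function.LeftInverse dec enc)
    (Msg : ℕ → (Fin w → Fin (2^p)) × (Fin w → Fin (2^p)) × Fin n × Fin n × ℕ →
      (Fin w → Fin (2^p)))
    (Up : ℕ → (Fin w → ℝ) → (Fin w → Fin (2^p)))
    (G : SimpleGraph (Fin n)) (a : Fin n → Fin w → Fin (2^p)) (β : Fin n → Fin n → ℕ)
    (ℓ : ℕ) (i : Fin n) :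
    congestState Prod.fst (fun _ => enc) (gnnUpdate Msg Up dec) G a β ℓ i =
      fpState Msg Up G a β ℓ i := by
  induction ℓ generalizing i with
  | zero => rfl
  | succ ℓ ih =>
    simp only [congestState, fpState, ih, gnnUpdate]
    rw [attributeOf_map hdec _ _ _ (mem_Nstar_self G i), Multiset.map_map]
    simp only [Function.comp_def, hdec _]
    rfl

/-- **Lower-bound transfer theorem (CONGEST → GNN).**  Fix `n ≥ 2` and `d, b, w, p` with
`p ≥ 1` and `w·p + ⌈log₂ n⌉ ≤ b`, and let `P` be a predicate on `n`-node inputs with node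
attributes in `S := Fin w → Fin (2^p)`.  If for every state type `St` no `b`-bit CONGEST
algorithm of `d` rounds decides `P`, then no finite-precision message-passing GNN of
depth `d`, width `w`, and precision `p` decides `P`. -/
theorem congest_to_gnn_lower_bound_transfer
    (n d b w p : ℕ) (hn : 2 ≤ n) (hp : 1 ≤ p)
    (hb : w * p + Nat.clog 2 n ≤ b)
    (P : SimpleGraph (Fin n) → (Fin n → Fin w → Fin (2^p)) → (Fin n → Fin n → ℕ) → Prop)
    (hcongest : ∀ (St : Type)
        (init : (Fin w → Fin (2^p)) × Fin n → St)
        (M : ℕ → St × Fin n → Fin (2^b))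
        (U : ℕ → Multiset (Fin (2^b) × ℕ) × Fin n → St)
        (out : St → Bool),
        ¬ ∀ (G : SimpleGraph (Fin n)) (a : Fin n → Fin w → Fin (2^p))
            (β : Fin n → Fin n → ℕ),
            ((∀ i, out (congestState init M U G a β d i) = true) ↔ P G a β)) :
    ∀ (Msg : ℕ → (Fin w → Fin (2^p)) × (Fin w → Fin (2^p)) × Fin n × Fin n × ℕ →
          (Fin w → Fin (2^p)))
      (Up : ℕ → (Fin w → ℝ) → (Fin w → Fin (2^p)))
      (out : (Fin w → Fin (2^p)) → Bool),
      ¬ ∀ (G : SimpleGraph (Fin n)) (a : Fin n → Fin w → Fin (2^p))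
          (β : Fin n → Fin n → ℕ),
          ((∀ i, out (fpState Msg Up G a β d i) = true) ↔ P G a β) := by
  intro Msg Up out hdecides
  have : Nonempty ((Fin w → Fin (2^p)) × Fin n) := ⟨(zeroS w p, ⟨0, by omega⟩)⟩
  obtain ⟨enc, henc⟩ := exists_injective_encoding (n := n) hb
  refine hcongest _ Prod.fst (fun _ => enc) (gnnUpdate Msg Up (Function.invFun enc)) out ?_
  simpa only [congestState_gnnUpdate (Function.leftInverse_invFun henc)] using hdecides
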